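/- Let Γ be a subgroup of ℂ × ℤ₂ and let sW_Γ be the Γ-Witt superalgebra. The automorphism group of sW_Γ is exactly {φ_{a,f} | f ∈ Γ^∨, a ∈ ℂ* with a²Γ = Γ and Re(a) ≥ 0}, where φ_{a,f} is the Lie superalgebra automorphism determined by φ_{a,f}(L_m) = a² f(m) L_{m/a²} for m ∈ Γ_0 and φ_{a,f}(G_r) = a f(r) G_{r/a²} for r ∈ Γ_1. -/

import Mathlib

open Finsupp

/-- The `Γ`-Witt superalgebra bracket on `↥Γ →₀ ℂ` for `Γ ⊆ ℂ × ℤ₂`; the basis vector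
indexed by `p ∈ Γ` is `L_m` if `p = (m, 0)` and `G_r` if `p = (r, 1)`, and
`[L_m, L_n] = (m-n)L_{m+n}`, `[L_m, G_r] = (m/2 - r)G_{m+r} = -[G_r, L_m]`,
`[G_r, G_s] = 2L_{r+s}`. -/
noncomputable def sWittBracket (Γ : AddSubgroup (ℂ × ZMod 2)) (x y : ↥Γ →₀ ℂ) :
    ↥Γ →₀ ℂ :=
  x.sum fun p a => y.sum fun q b =>
    (a * b) •
      (if (p : ℂ × ZMod 2).2 = 0 then
        (if (q : ℂ × ZMod 2).2 = 0 then
          ((p : ℂ × ZMod 2).1 - (q : ℂ × ZMod 2).1) • Finsupp.single (p + q) (1 : ℂ)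
        else
          ((p : ℂ × ZMod 2).1 / 2 - (q : ℂ × ZMod 2).1) • Finsupp.single (p + q) (1 : ℂ))
      else
        (if (q : ℂ × ZMod 2).2 = 0 then
          (-((q : ℂ × ZMod 2).1 / 2 - (p : ℂ × ZMod 2).1)) • Finsupp.single (p + q) (1 : ℂ)
        else
          (2 : ℂ) • Finsupp.single (p + q) (1 : ℂ)))

/-- structure constants -/
noncomputable def sB (p q : ℂ × ZMod 2) : ℂ :=
  if p.2 = 0 then (if q.2 = 0 then p.1 - q.1 else p.1 / 2 - q.1)
  else (if q.2 = 0 then -(q.1 / 2 - p.1) else 2)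

lemma sWitt_eq (Γ : AddSubgroup (ℂ × ZMod 2)) (x y : ↥Γ →₀ ℂ) :
    sWittBracket Γ x y = x.sum fun p a => y.sum fun q b =>
      Finsupp.single (p + q) (a * b * sB p q) := by
  unfold sWittBracket sB
  refine Finsupp.sum_congr fun p _ => Finsupp.sum_congr fun q _ => ?_
  split_ifs <;> simp only [Finsupp.smul_single, smul_eq_mul, mul_one]

lemma sWitt_single (Γ : AddSubgroup (ℂ × ZMod 2)) (p q : ↥Γ) (a b : ℂ) :
    sWittBracket Γ (single p a) (single q b) = single (p + q) (a * b * sB p q) := by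
  rw [sWitt_eq, Finsupp.sum_single_index, Finsupp.sum_single_index] <;> simp

lemma sWitt_add_left (Γ : AddSubgroup (ℂ × ZMod 2)) (x x' y : ↥Γ →₀ ℂ) :
    sWittBracket Γ (x + x') y = sWittBracket Γ x y + sWittBracket Γ x' y := by
  simp only [sWitt_eq]
  rw [Finsupp.sum_add_index']
  · simp
  · intro p a b
    rw [← Finsupp.sum_add]
    refine Finsupp.sum_congr fun q _ => ?_
    rw [← Finsupp.single_add]; congr 1; ring

lemma sWitt_add_right (Γ : AddSubgroup (ℂ × ZMod 2)) (x y y' : ↥Γ →₀ ℂ) :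
    sWittBracket Γ x (y + y') = sWittBracket Γ x y + sWittBracket Γ x y' := by
  simp only [sWitt_eq]
  rw [← Finsupp.sum_add]
  refine Finsupp.sum_congr fun p _ => ?_
  rw [Finsupp.sum_add_index']
  · simp
  · intro q a b
    rw [← Finsupp.single_add]; congr 1; ring

lemma sWitt_zero_left (Γ : AddSubgroup (ℂ × ZMod 2)) (y : ↥Γ →₀ ℂ) :
    sWittBracket Γ 0 y = 0 := by simp [sWitt_eq]

lemma sWitt_zero_right (Γ : AddSubgroup (ℂ × ZMod 2)) (y : ↥Γ →₀ ℂ) :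
    sWittBracket Γ y 0 = 0 := by simp [sWitt_eq]

lemma sWitt_apply (Γ : AddSubgroup (ℂ × ZMod 2)) (x y : ↥Γ →₀ ℂ) (r : ↥Γ) :
    sWittBracket Γ x y r = ∑ p ∈ x.support, ∑ q ∈ y.support,
      if p + q = r then x p * y q * sB p q else 0 := by
  classical
  rw [sWitt_eq]
  simp only [Finsupp.sum, Finsupp.finsetSum_apply, Finsupp.single_apply]

lemma sB_zero (q : ℂ × ZMod 2) : sB 0 q = -q.1 := by
  simp [sB]

lemma sWitt_L0 (Γ : AddSubgroup (ℂ × ZMod 2)) (c : ℂ) (y : ↥Γ →₀ ℂ) (q : ↥Γ) :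
    sWittBracket Γ (single 0 c) y q = - c * (q : ℂ × ZMod 2).1 * y q := by
  classical
  rw [sWitt_eq, Finsupp.sum_single_index (by simp)]
  simp only [Finsupp.sum, Finsupp.finsetSum_apply, Finsupp.single_apply, zero_add]
  rw [Finset.sum_ite_eq']
  split_ifs with h
  · simp [sB_zero]; ring
  · simp at h; simp [h]

lemma zmod2_cases (a : ZMod 2) : a = 0 ∨ a = 1 := by
  revert a; decide

/-- surjectivity: each index occurs in the support of the image of some basis vector -/
lemma exists_mem_supp (Γ : AddSubgroup (ℂ × ZMod 2)) (φ : (↥Γ →₀ ℂ) ≃ₗ[ℂ] (↥Γ →₀ ℂ)) (q : ↥Γ) :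
    ∃ p, φ (single p 1) q ≠ 0 := by
  by_contra! h
  have key : ∀ y, φ y q = 0 := by
    intro y
    induction y using Finsupp.induction_linear with
    | zero => simp
    | add f g hf hg => simp [hf, hg]
    | single p a =>
      have : single p a = a • single p (1 : ℂ) := by simp
      rw [this, map_smul]; simp [h]
  have := key (φ.symm (single q 1))
  simp at this

/-- support of `φ L_0` has no positive part for an order -/
lemma no_pos {O : Type*} [AddCommGroup O] [LinearOrder O] [IsOrderedAddMonoid O]
    (ℓ : ℂ →+ O) (hℓ : Function.Injective ℓ)
    (Γ : AddSubgroup (ℂ × ZMod 2)) (φ : (↥Γ →₀ ℂ) ≃ₗ[ℂ] (↥Γ →₀ ℂ))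
    (hφ : ∀ x y, φ (sWittBracket Γ x y) = sWittBracket Γ (φ x) (φ y))
    (hev : ∀ p : ↥Γ, ∀ q ∈ (φ (Finsupp.single p 1)).support,
        (q : ℂ × ZMod 2).2 = (p : ℂ × ZMod 2).2)
    (q : ↥Γ) (hq : q ∈ (φ (single 0 1)).support) : ℓ (q : ℂ × ZMod 2).1 ≤ 0 := by
  classical
  by_contra! hpos
  set x := φ (single 0 1) with hx
  obtain ⟨m, hm, hmax⟩ := Finset.exists_max_image x.support
    (fun q => ℓ (q : ℂ × ZMod 2).1) ⟨q, hq⟩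
  have hm0 : 0 < ℓ (m : ℂ × ZMod 2).1 := hpos.trans_le (hmax q hq)
  have hm2 : (m : ℂ × ZMod 2).2 = 0 := by simpa using hev 0 m hm
  have key : ∀ n : ↥Γ, (n : ℂ × ZMod 2).2 = 0 → ∀ r ∈ (φ (single n 1)).support,
      ℓ (r : ℂ × ZMod 2).1 ≤ ℓ (m : ℂ × ZMod 2).1 := by
    intro n hn r hr
    set z := φ (single n 1) with hz
    obtain ⟨p, hp, hpmax⟩ := Finset.exists_max_image z.support
      (fun q => ℓ (q : ℂ × ZMod 2).1) ⟨r, hr⟩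
    have hp2 : (p : ℂ × ZMod 2).2 = 0 := (hev n p hp).trans hn
    have hbr : sWittBracket Γ x z = (-(n : ℂ × ZMod 2).1) • z := by
      rw [hx, hz, ← hφ, sWitt_single, ← map_smul]
      congr 1
      simp [sB_zero]
    have h1 := congrArg (fun w => w (m + p)) hbr
    have hz0 : z (m + p) = 0 := by
      by_contra hne
      have := hpmax (m + p) (by simpa using hne)
      simp at this
      exact absurd this (not_le.mpr hm0)
    simp only [Finsupp.smul_apply, hz0, smul_zero] at h1
    rw [sWitt_apply, Finset.sum_eq_single m, Finset.sum_eq_single p] at h1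
    · have hxm : x m ≠ 0 := by simpa using hm
      have hzp : z p ≠ 0 := by simpa using hp
      simp [hxm, hzp, sB, hm2, hp2] at h1
      rw [sub_eq_zero] at h1
      rw [h1]; exact hpmax r hr
    · intro b hb hbp
      rw [if_neg]
      intro h; exact hbp (add_left_cancel h)
    · intro h; exact absurd hp h
    · intro b hb hbm
      refine Finset.sum_eq_zero fun b' hb' => ?_
      rw [if_neg]
      intro h
      apply hbm
      have e1 := hmax b hb
      have e2 := hpmax b' hb'
      have e3 : ℓ (b : ℂ × ZMod 2).1 + ℓ (b' : ℂ × ZMod 2).1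
          = ℓ (m : ℂ × ZMod 2).1 + ℓ (p : ℂ × ZMod 2).1 := by
        rw [← map_add, ← map_add]
        have := congrArg (fun t : ↥Γ => ℓ (t : ℂ × ZMod 2).1) h
        simpa using this
      have e4 : ℓ (b : ℂ × ZMod 2).1 = ℓ (m : ℂ × ZMod 2).1 := by
        refine le_antisymm e1 ?_
        by_contra! hlt
        exact absurd e3 (add_lt_add_of_lt_of_le hlt e2).ne
      apply Subtype.ext
      apply Prod.ext
      · exact hℓ e4
      · rw [hm2]; simpa using hev 0 b hb
    · intro h; exact absurd hm h
  obtain ⟨n, hn⟩ := exists_mem_supp Γ φ (m + m)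
  have hn' : m + m ∈ (φ (single n 1)).support := by simpa using hn
  have hn2 : (n : ℂ × ZMod 2).2 = 0 := by
    rw [← hev n _ hn']; simp [hm2]
  have := key n hn2 _ hn'
  simp at this
  exact absurd this (not_le.mpr hm0)

/-- lexicographic order on the complex numbers -/
def lexHom : ℂ →+ (ℝ ×ₗ ℝ) where
  toFun z := toLex (z.re, z.im)
  map_zero' := rfl
  map_add' _ _ := rfl

lemma lexHom_inj : Function.Injective lexHom := by
  intro z w h
  have h' : (z.re, z.im) = (w.re, w.im) := toLex.injective h
  simp only [Prod.mk.injEq] at h'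
  exact Complex.ext h'.1 h'.2

lemma phi_L0 (Γ : AddSubgroup (ℂ × ZMod 2)) (φ : (↥Γ →₀ ℂ) ≃ₗ[ℂ] (↥Γ →₀ ℂ))
    (hφ : ∀ x y, φ (sWittBracket Γ x y) = sWittBracket Γ (φ x) (φ y))
    (hev : ∀ p : ↥Γ, ∀ q ∈ (φ (Finsupp.single p 1)).support,
        (q : ℂ × ZMod 2).2 = (p : ℂ × ZMod 2).2) :
    ∃ c : ℂ, c ≠ 0 ∧ φ (single 0 1) = single 0 c := by
  have hs : ∀ q, q ≠ 0 → φ (single 0 1) q = 0 := by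
    intro q hq
    by_contra hne
    have hq' : q ∈ (φ (single 0 1)).support := by simpa using hne
    have h1 := no_pos lexHom lexHom_inj Γ φ hφ hev q hq'
    have h2 := no_pos (-lexHom) (fun a b h => lexHom_inj (neg_injective h)) Γ φ hφ hev q hq'
    simp only [AddMonoidHom.neg_apply, Left.neg_nonpos_iff] at h2
    have h3 : (q : ℂ × ZMod 2).1 = 0 := lexHom_inj (by rw [map_zero]; exact le_antisymm h1 h2)
    apply hq
    apply Subtype.ext
    exact Prod.ext h3 (by simpa using hev 0 q hq')
  have h : φ (single 0 1) = single 0 (φ (single 0 1) 0) := by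
    ext q
    by_cases hq : q = 0
    · subst hq; simp
    · rw [hs q hq, Finsupp.single_eq_of_ne hq]
  refine ⟨_, ?_, h⟩
  intro h0
  rw [h0] at h
  simp at h

lemma sB_scale (c : ℂ) (hc : c ≠ 0) (p q : ℂ × ZMod 2) :
    sB (p.1 / c, p.2) (q.1 / c, q.2) =
      if p.2 ≠ 0 ∧ q.2 ≠ 0 then sB p q else sB p q / c := by
  unfold sB
  by_cases h1 : p.2 = 0 <;> by_cases h2 : q.2 = 0 <;> simp [h1, h2] <;> field_simp

/-- `Aut(sW_Γ) = {φ_{a,f} | f ∈ Γ^∨, a ∈ ℂ*, a²Γ = Γ, Re a ≥ 0}` where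
`φ_{a,f}(L_m) = a² f(m) L_{m/a²}` and `φ_{a,f}(G_r) = a f(r) G_{r/a²}`:
(1) every such `φ_{a,f}` extends to an automorphism of the Lie superalgebra `sW_Γ`
(an even linear self-equivalence preserving the bracket), and (2) every automorphism
of `sW_Γ` is of this form. -/
theorem stmt2 (Γ : AddSubgroup (ℂ × ZMod 2)) :
    (∀ (a : ℂ) (ha0 : a ≠ 0) (hare : 0 ≤ a.re)
      (ha : ∀ q : ℂ × ZMod 2, q ∈ Γ ↔ ((a ^ 2 * q.1, q.2) : ℂ × ZMod 2) ∈ Γ)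
      (f : ↥Γ → ℂ), (∀ p, f p ≠ 0) → (∀ p q, f (p + q) = f p * f q) →
      ∃ φ : (↥Γ →₀ ℂ) ≃ₗ[ℂ] (↥Γ →₀ ℂ),
        (∀ x y, φ (sWittBracket Γ x y) = sWittBracket Γ (φ x) (φ y)) ∧
        ∀ p : ↥Γ, φ (Finsupp.single p 1) =
          (if (p : ℂ × ZMod 2).2 = 0 then a ^ 2 * f p else a * f p) •
            Finsupp.single
              (⟨((p : ℂ × ZMod 2).1 / a ^ 2, (p : ℂ × ZMod 2).2),
                (ha ((p : ℂ × ZMod 2).1 / a ^ 2, (p : ℂ × ZMod 2).2)).mpr (by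
                  rw [show a ^ 2 * ((p : ℂ × ZMod 2).1 / a ^ 2) = (p : ℂ × ZMod 2).1 by
                    field_simp]
                  exact p.2)⟩ : ↥Γ) 1) ∧
    (∀ φ : (↥Γ →₀ ℂ) ≃ₗ[ℂ] (↥Γ →₀ ℂ),
      (∀ x y, φ (sWittBracket Γ x y) = sWittBracket Γ (φ x) (φ y)) →
      -- `φ` is even, i.e. preserves the `ℤ₂`-grading
      (∀ p : ↥Γ, ∀ q ∈ (φ (Finsupp.single p 1)).support,
        (q : ℂ × ZMod 2).2 = (p : ℂ × ZMod 2).2) →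
      ∃ (a : ℂ) (ha0 : a ≠ 0) (hare : 0 ≤ a.re)
        (ha : ∀ q : ℂ × ZMod 2, q ∈ Γ ↔ ((a ^ 2 * q.1, q.2) : ℂ × ZMod 2) ∈ Γ)
        (f : ↥Γ → ℂ), (∀ p, f p ≠ 0) ∧ (∀ p q, f (p + q) = f p * f q) ∧
        ∀ p : ↥Γ, φ (Finsupp.single p 1) =
          (if (p : ℂ × ZMod 2).2 = 0 then a ^ 2 * f p else a * f p) •
            Finsupp.single
              (⟨((p : ℂ × ZMod 2).1 / a ^ 2, (p : ℂ × ZMod 2).2),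
                (ha ((p : ℂ × ZMod 2).1 / a ^ 2, (p : ℂ × ZMod 2).2)).mpr (by
                  rw [show a ^ 2 * ((p : ℂ × ZMod 2).1 / a ^ 2) = (p : ℂ × ZMod 2).1 by
                    field_simp]
                  exact p.2)⟩ : ↥Γ) 1) := by
  constructor
  · intro a ha0 hare ha f hf0 hf
    have ha2 : a ^ 2 ≠ 0 := pow_ne_zero 2 ha0
    let σ : ↥Γ → ↥Γ := fun p => ⟨((p : ℂ × ZMod 2).1 / a ^ 2, (p : ℂ × ZMod 2).2),
                (ha ((p : ℂ × ZMod 2).1 / a ^ 2, (p : ℂ × ZMod 2).2)).mpr (by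
                  rw [show a ^ 2 * ((p : ℂ × ZMod 2).1 / a ^ 2) = (p : ℂ × ZMod 2).1 by
                    field_simp]
                  exact p.2)⟩
    let τ : ↥Γ → ↥Γ := fun p => ⟨(a ^ 2 * (p : ℂ × ZMod 2).1, (p : ℂ × ZMod 2).2),
      (ha p).mp p.2⟩
    have hστ : ∀ p, σ (τ p) = p := fun p => Subtype.ext (Prod.ext (by simp [σ, τ, ha0]) rfl)
    have hτσ : ∀ p, τ (σ p) = p := fun p => Subtype.ext (Prod.ext (by simp [σ, τ]; field_simp) rfl)
    have hσa : ∀ p q, σ (p + q) = σ p + σ q := fun p q =>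
      Subtype.ext (Prod.ext (by simp [σ, add_div]) rfl)
    let h : ↥Γ → ℂ := fun p => if (p : ℂ × ZMod 2).2 = 0 then a ^ 2 * f p else a * f p
    have hh : ∀ p, h p ≠ 0 := by
      intro p; simp only [h]; split_ifs <;> simp [ha0, hf0]
    let F : (↥Γ →₀ ℂ) →ₗ[ℂ] (↥Γ →₀ ℂ) :=
      Finsupp.linearCombination ℂ (fun p => h p • single (σ p) (1 : ℂ))
    let G : (↥Γ →₀ ℂ) →ₗ[ℂ] (↥Γ →₀ ℂ) :=
      Finsupp.linearCombination ℂ (fun p => (h (τ p))⁻¹ • single (τ p) (1 : ℂ))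
    have hF : ∀ p b, F (single p b) = single (σ p) (b * h p) := by
      intro p b; simp [F, Finsupp.linearCombination_single]
    have hG : ∀ p b, G (single p b) = single (τ p) (b * (h (τ p))⁻¹) := by
      intro p b; simp [G, Finsupp.linearCombination_single]
    let φ : (↥Γ →₀ ℂ) ≃ₗ[ℂ] (↥Γ →₀ ℂ) := LinearEquiv.ofLinearMap F G
      (by
        refine Finsupp.lhom_ext fun p b => ?_
        rw [LinearMap.comp_apply, hG, hF, hστ, mul_assoc, inv_mul_cancel₀ (hh _)]; simp)
      (by
        refine Finsupp.lhom_ext fun p b => ?_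
        rw [LinearMap.comp_apply, hF, hG, hτσ, mul_assoc, mul_inv_cancel₀ (hh _)]; simp)
    have hφF : ∀ x, φ x = F x := fun x => rfl
    refine ⟨φ, ?_, ?_⟩
    · intro x y
      simp only [hφF]
      induction x using Finsupp.induction_linear with
      | zero => simp [sWitt_zero_left]
      | add x x' hx hx' => rw [sWitt_add_left, map_add, map_add, sWitt_add_left, hx, hx']
      | single p b =>
        induction y using Finsupp.induction_linear with
        | zero => simp [sWitt_zero_right]
        | add x x' hx hx' => rw [sWitt_add_right, map_add, map_add, sWitt_add_right, hx, hx']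
        | single q d =>
          rw [sWitt_single, hF, hF, hF, sWitt_single, hσa]
          congr 1
          have e : sB (σ p) (σ q) = _ := sB_scale (a ^ 2) ha2 p q
          rw [e]
          simp only [h, hf]
          rcases zmod2_cases (p : ℂ × ZMod 2).2 with h1 | h1 <;>
          rcases zmod2_cases (q : ℂ × ZMod 2).2 with h2 | h2 <;>
          simp [h1, h2, show (1 : ZMod 2) + 1 = 0 from rfl] <;> field_simp
    · intro p
      rw [hφF, hF]
      rw [Finsupp.smul_single, smul_eq_mul, mul_one, one_mul]
  · intro φ hφ hev
    obtain ⟨c, hc, hφ0⟩ := phi_L0 Γ φ hφ hev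
    obtain ⟨a, hare, hac⟩ : ∃ a : ℂ, 0 ≤ a.re ∧ a ^ 2 = c := by
      obtain ⟨b, hb⟩ := IsAlgClosed.exists_pow_nat_eq c (n := 2) (by norm_num)
      rcases le_total 0 b.re with h | h
      · exact ⟨b, h, hb⟩
      · exact ⟨-b, by simpa using h, by simpa using hb⟩
    have ha0 : a ≠ 0 := by rintro rfl; apply hc; rw [← hac]; simp
    subst hac
    have hsupp : ∀ p q : ↥Γ, φ (single p 1) q ≠ 0 →
        (q : ℂ × ZMod 2) = ((p : ℂ × ZMod 2).1 / a ^ 2, (p : ℂ × ZMod 2).2) := by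
      intro p q hq
      have h1 := hφ (single 0 1) (single p 1)
      rw [hφ0, sWitt_single] at h1
      have h2 := congrArg (fun w => w q) h1
      have e : single (0 + p) (1 * 1 * sB ((0 : ↥Γ) : ℂ × ZMod 2) p)
        = (-(p : ℂ × ZMod 2).1) • single p (1 : ℂ) := by simp [sB_zero]
      simp only [sWitt_L0] at h2
      rw [e, map_smul, Finsupp.smul_apply, smul_eq_mul] at h2
      have h3 := mul_right_cancel₀ hq h2
      refine Prod.ext ?_ (hev p q (by simpa using hq))
      simp only
      rw [eq_div_iff hc]
      linear_combination h3
    have ha : ∀ q : ℂ × ZMod 2, q ∈ Γ ↔ ((a ^ 2 * q.1, q.2) : ℂ × ZMod 2) ∈ Γ := by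
      intro q
      constructor
      · intro hq
        obtain ⟨p, hp⟩ := exists_mem_supp Γ φ ⟨q, hq⟩
        have := hsupp p _ hp
        simp only at this
        have e : ((a ^ 2 * q.1, q.2) : ℂ × ZMod 2) = p := by
          rw [this]; exact Prod.ext (by simp; field_simp) rfl
        rw [e]; exact p.2
      · intro hq
        have hne : φ (single ⟨_, hq⟩ 1) ≠ 0 := by simp
        obtain ⟨r, hr⟩ := Finsupp.ne_iff.mp hne
        have := hsupp _ r hr
        have e : q = r := by
          rw [this]; exact Prod.ext (by simp; field_simp) rfl
        rw [e]; exact r.2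
    let σ : ↥Γ → ↥Γ := fun p => ⟨((p : ℂ × ZMod 2).1 / a ^ 2, (p : ℂ × ZMod 2).2),
                (ha ((p : ℂ × ZMod 2).1 / a ^ 2, (p : ℂ × ZMod 2).2)).mpr (by
                  rw [show a ^ 2 * ((p : ℂ × ZMod 2).1 / a ^ 2) = (p : ℂ × ZMod 2).1 by
                    field_simp]
                  exact p.2)⟩
    have hσa : ∀ p q, σ (p + q) = σ p + σ q := fun p q =>
      Subtype.ext (Prod.ext (by simp [σ, add_div]) rfl)
    let g : ↥Γ → ℂ := fun p => φ (single p 1) (σ p)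
    have hg : ∀ p, φ (single p 1) = single (σ p) (g p) := by
      intro p
      ext q
      by_cases hq : q = σ p
      · subst hq; simp [g]
      · rw [Finsupp.single_eq_of_ne hq]
        by_contra hne
        exact hq (Subtype.ext (hsupp p q hne))
    have hg0 : ∀ p, g p ≠ 0 := by
      intro p h0
      have := hg p
      rw [h0] at this
      simp at this
    have hgz : g 0 = a ^ 2 := by
      have : σ 0 = 0 := Subtype.ext (Prod.ext (by simp [σ]) rfl)
      simp [g, hφ0, this]
    have hgB : ∀ p q : ↥Γ, g (p + q) * sB p q = g p * g q * sB (σ p) (σ q) := by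
      intro p q
      have h1 := hφ (single p 1) (single q 1)
      have e : single (p + q) (1 * 1 * sB (p : ℂ × ZMod 2) q)
        = sB p q • single (p + q) (1 : ℂ) := by simp
      rw [sWitt_single, e, map_smul, hg, hg, hg, sWitt_single, ← hσa] at h1
      have h2 := congrArg (fun w => w (σ (p + q))) h1
      simp at h2
      rw [mul_comm, h2]
    let f : ↥Γ → ℂ := fun p => if (p : ℂ × ZMod 2).2 = 0 then g p / a ^ 2 else g p / a
    have hf0 : ∀ p, f p ≠ 0 := by
      intro p; simp only [f]; split_ifs <;> simp [ha0, hg0]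
    have hfz : f 0 = 1 := by simp [f, hgz, ha0]
    have hfB : ∀ p q : ↥Γ, sB (p : ℂ × ZMod 2) q ≠ 0 → f (p + q) = f p * f q := by
      intro p q hB
      have h1 := hgB p q
      have e : sB (σ p) (σ q) = _ := sB_scale (a ^ 2) hc p q
      rw [e] at h1
      simp only [f]
      rcases zmod2_cases (p : ℂ × ZMod 2).2 with h1p | h1p <;>
      rcases zmod2_cases (q : ℂ × ZMod 2).2 with h2q | h2q <;>
      simp [h1p, h2q, show (1 : ZMod 2) + 1 = 0 from rfl] at h1 ⊢
      · have h3 : g (p + q) = g p * g q / a ^ 2 := mul_right_cancel₀ hB (by rw [h1]; ring)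
        rw [h3]; field_simp
      · have h3 : g (p + q) = g p * g q / a ^ 2 := mul_right_cancel₀ hB (by rw [h1]; ring)
        rw [h3]; field_simp
      · have h3 : g (p + q) = g p * g q / a ^ 2 := mul_right_cancel₀ hB (by rw [h1]; ring)
        rw [h3]; field_simp
      · have h3 : g (p + q) = g p * g q := h1.resolve_right hB
        rw [h3]; field_simp
    have hfe : ∀ p q : ↥Γ, (p : ℂ × ZMod 2).2 = 0 → f (p + q) = f p * f q := by
      intro p q hp
      by_cases hp0 : (p : ℂ × ZMod 2).1 = 0
      · have : p = 0 := Subtype.ext (Prod.ext hp0 hp)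
        rw [this, hfz]; simp
      by_cases hB : sB (p : ℂ × ZMod 2) q = 0
      · have h1 : f (p + -p) = f p * f (-p) := by
          apply hfB
          simp [sB, hp]
          intro h; apply hp0; linear_combination h
        have h2 : f (-p + (p + q)) = f (-p) * f (p + q) := by
          apply hfB
          rcases zmod2_cases (q : ℂ × ZMod 2).2 with h2q | h2q
          · simp [sB, hp, h2q] at hB ⊢
            intro h; apply hp0; linear_combination (hB - h) / 3
          · simp [sB, hp, h2q] at hB ⊢
            intro h; apply hp0; linear_combination (hB - h) / 2
        rw [add_neg_cancel, hfz] at h1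
        rw [neg_add_cancel_left] at h2
        rw [h2, ← mul_assoc, ← h1, one_mul]
      · exact hfB p q hB
    refine ⟨a, ha0, hare, ha, f, hf0, ?_, ?_⟩
    · intro p q
      rcases zmod2_cases (p : ℂ × ZMod 2).2 with h1p | h1p
      · exact hfe p q h1p
      rcases zmod2_cases (q : ℂ × ZMod 2).2 with h2q | h2q
      · rw [add_comm, hfe q p h2q, mul_comm]
      · apply hfB; simp [sB, h1p, h2q]
    · intro p
      have e : g p = if (p : ℂ × ZMod 2).2 = 0 then a ^ 2 * f p else a * f p := by
        simp only [f]
        split_ifs with h1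
        · rw [mul_div_cancel₀ _ hc]
        · rw [mul_div_cancel₀ _ ha0]
      rw [Finsupp.smul_single, smul_eq_mul, mul_one, ← e]
      exact hg p
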